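/- arXiv:2011.07401 — 4 statements merged into one kernel-verified Lean document; each statement's English description precedes it below -/
import Mathlib

section
/- Let S be a countable discrete measurable state space, κ a Markov kernel on S, and μ a κ-invariant probability measure on S. Let Φ : S → ℝ satisfy 0 ≤ Φ(q) ≤ M for every q ∈ S. Let V > 0, ε > 0 and c ∈ ℝ with c + V < M. Assume: (i) for every q ∈ S, κ(q)-almost every q' satisfies |Φ(q') − Φ(q)| ≤ V; (ii) for every q ∈ S with c + V < Φ(q) < M one has ∫ Φ(q') κ(q)(dq') ≤ Φ(q) − ε. Then μ({q : c + V < Φ(q) ∧ Φ(q) < M}) ≤ (V/(V+ε)) · μ({q : c − V < Φ(q) ∧ Φ(q) < M}). -/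
open MeasureTheory ProbabilityTheory

/-- The mean drift of an integrable function vanishes under an invariant measure. -/
theorem integral_kernel_integral_of_bind_eq {S : Type*} [MeasurableSpace S] (κ : Kernel S S)
    (μ : Measure S) (hinv : μ.bind κ = μ) {f : S → ℝ} (hf : Integrable f μ) :
    ∫ q, ∫ q', f q' ∂(κ q) ∂μ = ∫ q, f q ∂μ := by
  have hcomp : (κ ∘ₖ Kernel.const Unit μ) () = μ := by
    rw [Kernel.comp_apply, Kernel.const_apply, hinv]
  have h := Kernel.integral_comp (η := κ) (κ := Kernel.const Unit μ) (a := ()) (f := f)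
    (by rwa [hcomp])
  rw [hcomp, Kernel.const_apply] at h
  exact h.symm

/-- One-step geometric-decay estimate (underlying Lemma 11, TailProb):
for a Markov kernel `κ` on a countable discrete state space `S`, a `κ`-invariant
probability measure `μ`, and a function `Φ` with `0 ≤ Φ ≤ M`, bounded jumps
(`|Φ(q') − Φ(q)| ≤ V` κ(q)-a.s.) and drift `≤ −ε` on `{c + V < Φ < M}` (with
`c + V < M`), one has
`μ({c + V < Φ < M}) ≤ (V/(V+ε)) · μ({c − V < Φ < M})`. -/
theorem stmt_0 {S : Type*} [Countable S] [MeasurableSpace S] [DiscreteMeasurableSpace S]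
    (κ : Kernel S S) [IsMarkovKernel κ]
    (μ : Measure S) [IsProbabilityMeasure μ]
    (hinv : μ.bind (fun q => κ q) = μ)
    (Φ : S → ℝ) (M : ℝ)
    (hΦ : ∀ q, 0 ≤ Φ q ∧ Φ q ≤ M)
    (V ε c : ℝ) (hV : 0 < V) (hε : 0 < ε) (hc : c + V < M)
    (hjump : ∀ q, ∀ᵐ q' ∂(κ q), |Φ q' - Φ q| ≤ V)
    (hdrift : ∀ q, c + V < Φ q → Φ q < M → ∫ q', Φ q' ∂(κ q) ≤ Φ q - ε) :
    (μ {q | c + V < Φ q ∧ Φ q < M}).toReal ≤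
      (V / (V + ε)) * (μ {q | c - V < Φ q ∧ Φ q < M}).toReal := by
  set f : S → ℝ := fun q => max c (Φ q)
  have hf_bd (q : S) : |f q| ≤ |c| + |M| := by
    have h1 : f q ≤ M := max_le (by linarith) (hΦ q).2
    have h2 : c ≤ f q := le_max_left _ _
    rw [abs_le]
    constructor <;> linarith [neg_abs_le c, le_abs_self M, abs_nonneg c, abs_nonneg M]
  have hint {g : S → ℝ} (ν : Measure S) [IsProbabilityMeasure ν] (C : ℝ)
      (hg : ∀ q, |g q| ≤ C) : Integrable g ν :=
    .of_bound (Measurable.of_discrete.aestronglyMeasurable) C (ae_of_all _ hg)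
  have hfκ (q : S) : Integrable f (κ q) := hint _ _ hf_bd
  have hle {g : S → ℝ} (q : S) (b : ℝ) (hg : Integrable g (κ q)) (h : ∀ᵐ q' ∂(κ q), g q' ≤ b) :
      ∫ q', g q' ∂(κ q) ≤ b := by
    simpa using integral_mono_ae hg (integrable_const b) h
  set A : Set S := {q | c + V < Φ q ∧ Φ q < M}
  set B : Set S := {q | c - V < Φ q ∧ Φ q < M}
  have hdrift_le (q : S) : ∫ q', f q' ∂(κ q) ≤
      f q + (B.indicator (fun _ => V) q - A.indicator (fun _ => V + ε) q) := by
    have hfq : c ≤ f q ∧ Φ q ≤ f q := ⟨le_max_left _ _, le_max_right _ _⟩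
    by_cases hqB : q ∈ B
    · by_cases hqA : q ∈ A
      · have heq : ∫ q', f q' ∂(κ q) = ∫ q', Φ q' ∂(κ q) := by
          refine integral_congr_ae ?_
          filter_upwards [hjump q] with q' h
          exact max_eq_right (by linarith [(abs_le.1 h).1, hqA.1])
        rw [Set.indicator_of_mem hqB, Set.indicator_of_mem hqA, heq]
        linarith [hdrift q hqA.1 hqA.2]
      · rw [Set.indicator_of_mem hqB, Set.indicator_of_notMem hqA]
        refine hle q _ (hfκ q) ?_
        filter_upwards [hjump q] with q' h
        exact max_le (by linarith) (by linarith [(abs_le.1 h).2])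
    · have hqA : q ∉ A := fun h => hqB ⟨by linarith [h.1], h.2⟩
      rw [Set.indicator_of_notMem hqB, Set.indicator_of_notMem hqA]
      refine hle q _ (hfκ q) ?_
      filter_upwards [hjump q] with q' h
      by_cases hM : Φ q < M
      · have : Φ q ≤ c - V := not_lt.1 fun h' => hqB ⟨h', hM⟩
        exact max_le (by linarith) (by linarith [(abs_le.1 h).2])
      · exact max_le (by linarith) (by linarith [(hΦ q').2])
  have hfμ : Integrable f μ := hint _ _ hf_bd
  have hBi : Integrable (B.indicator fun _ => V) μ := (integrable_const V).indicator .of_discrete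
  have hAi : Integrable (A.indicator fun _ => V + ε) μ :=
    (integrable_const (V + ε)).indicator .of_discrete
  have hκf : Integrable (fun q => ∫ q', f q' ∂(κ q)) μ := by
    refine hint _ (|c| + |M|) fun q => ?_
    simpa using norm_integral_le_of_norm_le_const (μ := κ q) (f := f) (ae_of_all _ hf_bd)
  have key := integral_mono hκf (hfμ.add (hBi.sub hAi)) hdrift_le
  rw [integral_kernel_integral_of_bind_eq κ μ hinv hfμ, integral_add' hfμ (hBi.sub hAi),
    integral_sub' hBi hAi, integral_indicator_const _ .of_discrete,
    integral_indicator_const _ .of_discrete] at key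
  simp only [smul_eq_mul, Measure.real] at key
  rw [div_mul_eq_mul_div, le_div_iff₀ (by linarith)]
  linarith
end

section
/- Let S be a countable discrete measurable state space, κ a Markov kernel on S, and μ a κ-invariant probability measure on S. Let Φ : S → ℝ satisfy 0 ≤ Φ(q) ≤ M for every q ∈ S. Let V > 0, ε > 0 and B ≥ 0 with B + V ≤ M. Assume: (i) for every q ∈ S, κ(q)-almost every q' satisfies |Φ(q') − Φ(q)| ≤ V; (ii) for every q ∈ S with B < Φ(q) < M one has ∫ Φ(q') κ(q)(dq') ≤ Φ(q) − ε. Set m* = ⌊(M + V − B)/(2V)⌋. Then μ({q : M − V < Φ(q) ∧ Φ(q) < M}) ≤ (V/(V+ε))^{m*}. -/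
open MeasureTheory ProbabilityTheory

/-- An invariant law gives zero mean to the drift of every bounded function. -/
lemma integral_integral_of_bind_eq {S : Type*} [MeasurableSpace S] [DiscreteMeasurableSpace S]
    [Countable S] (κ : Kernel S S) [IsMarkovKernel κ] (μ : Measure S) [IsProbabilityMeasure μ]
    (hinv : μ.bind (fun q => κ q) = μ) (g : S → ℝ) (C : ℝ) (hg : ∀ q, |g q| ≤ C) :
    ∫ q, ∫ q', g q' ∂(κ q) ∂μ = ∫ q, g q ∂μ := by
  have hcomp : κ ∘ₖ Kernel.const Unit μ = Kernel.const Unit μ := by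
    rw [Kernel.comp_const]
    exact congrArg _ hinv
  have hint : Integrable g ((κ ∘ₖ Kernel.const Unit μ) ()) := by
    rw [hcomp]
    exact Integrable.of_bound (measurable_of_countable g).aestronglyMeasurable C
      (Filter.Eventually.of_forall hg)
  have h := Kernel.integral_comp hint
  rw [hcomp] at h
  exact h.symm

/-- One-step geometric decay of the tail of an invariant law, below the level `M`. -/
lemma measureReal_tail_le_mul {S : Type*} [MeasurableSpace S] [DiscreteMeasurableSpace S]
    [Countable S] (κ : Kernel S S) [IsMarkovKernel κ] (μ : Measure S) [IsProbabilityMeasure μ]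
    (hinv : μ.bind (fun q => κ q) = μ) (Φ : S → ℝ) (M : ℝ) (hΦ : ∀ q, 0 ≤ Φ q ∧ Φ q ≤ M)
    (V ε B : ℝ) (hV : 0 < V) (hε : 0 < ε)
    (hjump : ∀ q, ∀ᵐ q' ∂(κ q), |Φ q' - Φ q| ≤ V)
    (hdrift : ∀ q, B < Φ q → Φ q < M → ∫ q', Φ q' ∂(κ q) ≤ Φ q - ε)
    (x : ℝ) (hBx : B ≤ x) (hxM : x < M) :
    μ.real {q | x < Φ q ∧ Φ q < M} ≤
      V / (V + ε) * μ.real {q | x - 2 * V < Φ q ∧ Φ q < M} := by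
  set g : S → ℝ := fun q => max (x - V) (Φ q)
  set A : Set S := {q | x < Φ q ∧ Φ q < M}
  set D : Set S := {q | x - 2 * V < Φ q ∧ Φ q < M}
  have hgC : ∀ q, |g q| ≤ |x - V| + M := fun q => by
    have h0 := hΦ q
    have h1 : g q ≤ |x - V| + M := max_le (by linarith [le_abs_self (x - V)])
      (by linarith [abs_nonneg (x - V)])
    have h2 : Φ q ≤ g q := le_max_right _ _
    exact abs_le.2 ⟨by linarith [abs_nonneg (x - V)], h1⟩
  have hint (f : S → ℝ) (C : ℝ) (hf : ∀ q, |f q| ≤ C) (ν : Measure S) [IsProbabilityMeasure ν] :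
      Integrable f ν :=
    Integrable.of_bound (measurable_of_countable f).aestronglyMeasurable C
      (Filter.Eventually.of_forall hf)
  have hgκ (q : S) : Integrable g (κ q) := hint g _ hgC _
  have hκbound (q : S) (b : ℝ) (h : ∀ᵐ q' ∂(κ q), g q' ≤ b) : ∫ q', g q' ∂(κ q) ≤ b := by
    simpa using integral_mono_ae (hgκ q) (integrable_const b) h
  have hpt (q : S) : ∫ q', g q' ∂(κ q) ≤
      g q + (D.indicator (fun _ => V) q - A.indicator (fun _ => V + ε) q) := by
    have hq := (hΦ q).2
    by_cases hqA : q ∈ A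
    · have hqD : q ∈ D := ⟨by linarith [hqA.1], hqA.2⟩
      have heq : ∫ q', g q' ∂(κ q) = ∫ q', Φ q' ∂(κ q) := by
        refine integral_congr_ae ?_
        filter_upwards [hjump q] with q' h
        exact max_eq_right (by linarith [(abs_le.1 h).1, hqA.1])
      have hgq : Φ q ≤ g q := le_max_right _ _
      rw [Set.indicator_of_mem hqA, Set.indicator_of_mem hqD, heq]
      linarith [hdrift q (hBx.trans_lt hqA.1) hqA.2]
    · by_cases hqD : q ∈ D
      · rw [Set.indicator_of_notMem hqA, Set.indicator_of_mem hqD]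
        refine hκbound q _ ?_
        filter_upwards [hjump q] with q' h
        have h1 : x - V ≤ g q := le_max_left _ _
        have h2 : Φ q ≤ g q := le_max_right _ _
        exact max_le (by linarith) (by linarith [(abs_le.1 h).2])
      · rw [Set.indicator_of_notMem hqA, Set.indicator_of_notMem hqD]
        refine hκbound q _ ?_
        have h1 : x - V ≤ g q := le_max_left _ _
        have h2 : Φ q ≤ g q := le_max_right _ _
        rcases hq.lt_or_eq with hlt | heq
        · have hle : Φ q ≤ x - 2 * V := not_lt.1 fun h => hqD ⟨h, hlt⟩
          filter_upwards [hjump q] with q' h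
          exact max_le (by linarith) (by linarith [(abs_le.1 h).2])
        · exact Filter.Eventually.of_forall fun q' =>
            max_le (by linarith) (by linarith [(hΦ q').2])
  have hstat := integral_integral_of_bind_eq κ μ hinv g _ hgC
  have hiD : Integrable (D.indicator fun _ => V) μ :=
    (integrable_const V).indicator (.of_discrete)
  have hiA : Integrable (A.indicator fun _ => V + ε) μ :=
    (integrable_const (V + ε)).indicator (.of_discrete)
  have hgμ : Integrable g μ := hint g _ hgC μ
  have hgκμ : Integrable (fun q => ∫ q', g q' ∂(κ q)) μ := by
    refine hint _ (|x - V| + M) (fun q => ?_) μ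
    simpa using norm_integral_le_of_norm_le_const (μ := κ q)
      (f := g) (Filter.Eventually.of_forall fun q' => hgC q')
  have hmono := integral_mono hgκμ (hgμ.add (hiD.sub hiA)) hpt
  simp only [Pi.add_apply, Pi.sub_apply] at hmono
  have hsplit := integral_add hgμ (hiD.sub hiA)
  simp only [Pi.sub_apply] at hsplit
  rw [hstat, hsplit, integral_sub hiD hiA,
    integral_indicator_const _ (.of_discrete), integral_indicator_const _ (.of_discrete)] at hmono
  simp only [smul_eq_mul] at hmono
  rw [div_mul_eq_mul_div, le_div_iff₀ (by positivity)]
  linarith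

/-- Iterated geometric tail bound (underlying Lemma 2 of the paper):
for a Markov kernel `κ` on a countable discrete state space `S`, a `κ`-invariant
probability measure `μ`, and `Φ` with `0 ≤ Φ ≤ M`, bounded jumps `V` and drift
`≤ −ε` on `{B < Φ < M}` (with `0 ≤ B`, `B + V ≤ M`), setting
`m* = ⌊(M + V − B)/(2V)⌋`, one has `μ({M − V < Φ < M}) ≤ (V/(V+ε))^(m*)`. -/
theorem stmt_1 {S : Type*} [Countable S] [MeasurableSpace S] [DiscreteMeasurableSpace S]
    (κ : Kernel S S) [IsMarkovKernel κ]
    (μ : Measure S) [IsProbabilityMeasure μ]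
    (hinv : μ.bind (fun q => κ q) = μ)
    (Φ : S → ℝ) (M : ℝ)
    (hΦ : ∀ q, 0 ≤ Φ q ∧ Φ q ≤ M)
    (V ε B : ℝ) (hV : 0 < V) (hε : 0 < ε) (hB : 0 ≤ B) (hBM : B + V ≤ M)
    (hjump : ∀ q, ∀ᵐ q' ∂(κ q), |Φ q' - Φ q| ≤ V)
    (hdrift : ∀ q, B < Φ q → Φ q < M → ∫ q', Φ q' ∂(κ q) ≤ Φ q - ε) :
    (μ {q | M - V < Φ q ∧ Φ q < M}).toReal ≤
      (V / (V + ε)) ^ (⌊(M + V - B) / (2 * V)⌋₊) := by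
  have hiter : ∀ m : ℕ, (m : ℝ) ≤ (M + V - B) / (2 * V) →
      μ.real {q | M - V < Φ q ∧ Φ q < M} ≤
        (V / (V + ε)) ^ m * μ.real {q | M - V - m * (2 * V) < Φ q ∧ Φ q < M} := by
    intro m
    induction m with
    | zero => intro _; simp
    | succ m ih =>
      intro hm
      have hm' := (le_div_iff₀ (by positivity)).1 hm
      push_cast at hm hm'
      have hmV : 0 ≤ (m : ℝ) * (2 * V) := by positivity
      have hstep := measureReal_tail_le_mul κ μ hinv Φ M hΦ V ε B hV hε hjump hdrift
        (M - V - m * (2 * V)) (by linarith) (by linarith)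
      have hx : M - V - m * (2 * V) - 2 * V = M - V - ((m + 1 : ℕ) : ℝ) * (2 * V) := by
        push_cast; ring
      rw [hx] at hstep
      refine (ih (by linarith)).trans ?_
      rw [pow_succ, mul_assoc]
      gcongr
  have hfloor := Nat.floor_le (a := (M + V - B) / (2 * V)) (div_nonneg (by linarith) (by linarith))
  exact (hiter _ hfloor).trans (mul_le_of_le_one_right (by positivity) measureReal_le_one)
end

section
/- Let D ≥ 1 and let W, U be natural numbers with 1 ≤ W < U. For Q ∈ ℕ^D write Q_max = max_{1≤i≤D} Q_i. Let β ≥ 1, b₁ ≥ 1, b₂ > 0 be reals and let Φ̃ : ℕ^D → ℝ be nonnegative and satisfy: (H1) for every Q with Q_max ≤ U, Q_max^β ≤ Φ̃(Q) ≤ b₁ · Q_max^β; (H2) for all Q, Q' with Q_max ≤ U, Q'_max ≤ U and |Q'_i − Q_i| ≤ W for every i, one has |Φ̃(Q') − Φ̃(Q)| ≤ b₂ · (Q_max^{β−1} + Q'^{β−1}_max). Define S^in = {Q ∈ ℕ^D : Q_max ≤ U and Φ̃(Q) ≤ (U−W)^β} and Φ'(Q) = (Φ̃(Q))^{1/β}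 for Q ∈ S^in, Φ'(Q) = U − W otherwise. Then for all Q, Q' ∈ ℕ^D with |Q'_i − Q_i| ≤ W for every i, |Φ'(Q') − Φ'(Q)| ≤ max{ b₁^{1/β} · W, (2b₂/β) · (1+W)^{β−1} }. -/
/-- The maximum coordinate of a queue-backlog vector `Q ∈ ℕ^D`, as a real number. -/
noncomputable def queueMax {D : ℕ} (Q : Fin D → ℕ) : ℝ := ((Finset.univ.sup Q : ℕ) : ℝ)

/-- The linearized Lyapunov function: `Φ'(Q) = Φ̃(Q)^(1/β)` on
`S^in = {Q : Q_max ≤ U ∧ Φ̃(Q) ≤ (U−W)^β}`, and `Φ'(Q) = U − W` otherwise. -/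
noncomputable def linPhi {D : ℕ} (W U : ℕ) (β : ℝ) (Φ : (Fin D → ℕ) → ℝ)
    (Q : Fin D → ℕ) : ℝ :=
  if queueMax Q ≤ (U : ℝ) ∧ Φ Q ≤ ((U : ℝ) - (W : ℝ)) ^ β then (Φ Q) ^ (1 / β)
  else (U : ℝ) - (W : ℝ)

theorem queueMax_nonneg {D : ℕ} (Q : Fin D → ℕ) : 0 ≤ queueMax Q := Nat.cast_nonneg _

theorem queueMax_le_add {D : ℕ} (W : ℕ) (Q Q' : Fin D → ℕ)
    (h : ∀ i, |(Q' i : ℝ) - (Q i : ℝ)| ≤ (W : ℝ)) : queueMax Q' ≤ queueMax Q + W := by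
  unfold queueMax
  norm_cast
  refine Finset.sup_le fun i _ => ?_
  have h₁ : Q i ≤ Finset.univ.sup Q := Finset.le_sup (Finset.mem_univ i)
  have h₂ : (Q' i : ℝ) ≤ Q i + W := by linarith [(abs_le.mp (h i)).2]
  have h₃ : Q' i ≤ Q i + W := by exact_mod_cast h₂
  omega

theorem queueMax_eq_zero_or_one_le {D : ℕ} (Q : Fin D → ℕ) :
    queueMax Q = 0 ∨ 1 ≤ queueMax Q := by
  unfold queueMax
  norm_cast
  omega

/-- Tangent-line inequality for the convex power `x ↦ x ^ β`. -/
theorem rpow_tangent_le {a c β : ℝ} (ha : 0 < a) (hc : 0 ≤ c) (hβ : 1 ≤ β) :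
    β * a ^ (β - 1) * (c - a) ≤ c ^ β - a ^ β := by
  have hB := one_add_mul_self_le_rpow_one_add
    (show -1 ≤ c / a - 1 by linarith [div_nonneg hc ha.le]) hβ
  rw [add_sub_cancel, Real.div_rpow hc ha.le, le_div_iff₀ (Real.rpow_pos_of_pos ha β)] at hB
  have hp : a ^ β = a ^ (β - 1) * a := by
    rw [← Real.rpow_add_one ha.ne', sub_add_cancel]
  have he : (1 + β * (c / a - 1)) * a ^ β = a ^ β + β * a ^ (β - 1) * (c - a) := by
    rw [hp]
    field_simp
  linarith

theorem sub_le_of_rpow_sub_rpow_le {a c m m' w β b : ℝ} (hβ : 1 ≤ β) (hb : 0 < b)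
    (hw : 0 ≤ w) (hm : 1 ≤ m) (hma : m ≤ a) (hm' : 0 ≤ m') (hmw : m' ≤ m + w) (hc : 0 ≤ c)
    (h : c ^ β - a ^ β ≤ b * (m ^ (β - 1) + m' ^ (β - 1))) :
    c - a ≤ 2 * b / β * (1 + w) ^ (β - 1) := by
  have ha : 0 < a := by linarith
  have hβ0 : 0 < β := by linarith
  have hβ1 : 0 ≤ β - 1 := by linarith
  have hA : 0 < a ^ (β - 1) := Real.rpow_pos_of_pos ha _
  have hT := rpow_tangent_le ha hc hβ
  have h₁ : m ^ (β - 1) ≤ a ^ (β - 1) := Real.rpow_le_rpow (by linarith) hma hβ1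
  have h₂ : m' ^ (β - 1) ≤ (1 + w) ^ (β - 1) * a ^ (β - 1) := by
    rw [← Real.mul_rpow (by linarith) ha.le]
    exact Real.rpow_le_rpow hm' (by nlinarith) hβ1
  have h₃ : 1 ≤ (1 + w) ^ (β - 1) := Real.one_le_rpow (by linarith) hβ1
  have h₄ : a ^ (β - 1) ≤ (1 + w) ^ (β - 1) * a ^ (β - 1) := le_mul_of_one_le_left hA.le h₃
  have h₅ : b * (m ^ (β - 1) + m' ^ (β - 1)) ≤
      b * (2 * ((1 + w) ^ (β - 1) * a ^ (β - 1))) :=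
    mul_le_mul_of_nonneg_left (by linarith) hb.le
  have h₆ : (β * (c - a)) * a ^ (β - 1) ≤ (2 * b * (1 + w) ^ (β - 1)) * a ^ (β - 1) := by
    linarith
  have h₇ := le_of_mul_le_mul_right h₆ hA
  rw [div_mul_eq_mul_div, le_div_iff₀ hβ0]
  linarith

/-- Bounded-jump property of the linearized Lyapunov function (Lemma 10, property 1):
under the norm-equivalence hypothesis (H1) and the bounded-one-step-change
hypothesis (H2) for `Φ̃`, for all `Q, Q'` with `|Q'_i − Q_i| ≤ W` for every `i`,
`|Φ'(Q') − Φ'(Q)| ≤ max{ b₁^(1/β)·W, (2b₂/β)·(1+W)^(β−1) }`. -/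
theorem stmt_2 {D : ℕ} (hD : 1 ≤ D) (W U : ℕ) (hW : 1 ≤ W) (hWU : W < U)
    (β b₁ b₂ : ℝ) (hβ : 1 ≤ β) (hb₁ : 1 ≤ b₁) (hb₂ : 0 < b₂)
    (Φ : (Fin D → ℕ) → ℝ) (hΦ0 : ∀ Q, 0 ≤ Φ Q)
    (H1 : ∀ Q : Fin D → ℕ, queueMax Q ≤ (U : ℝ) →
      (queueMax Q) ^ β ≤ Φ Q ∧ Φ Q ≤ b₁ * (queueMax Q) ^ β)
    (H2 : ∀ Q Q' : Fin D → ℕ, queueMax Q ≤ (U : ℝ) → queueMax Q' ≤ (U : ℝ) →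
      (∀ i, |(Q' i : ℝ) - (Q i : ℝ)| ≤ (W : ℝ)) →
      |Φ Q' - Φ Q| ≤ b₂ * ((queueMax Q) ^ (β - 1) + (queueMax Q') ^ (β - 1))) :
    ∀ Q Q' : Fin D → ℕ, (∀ i, |(Q' i : ℝ) - (Q i : ℝ)| ≤ (W : ℝ)) →
      |linPhi W U β Φ Q' - linPhi W U β Φ Q| ≤
        max (b₁ ^ (1 / β) * (W : ℝ)) (2 * b₂ / β * ((1 : ℝ) + (W : ℝ)) ^ (β - 1)) := by
  have hβ0 : 0 < β := by linarith
  have hWU' : (W : ℝ) < U := by exact_mod_cast hWU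
  have hpow : ∀ Q, (Φ Q ^ (1 / β)) ^ β = Φ Q := fun Q => by
    rw [one_div, Real.rpow_inv_rpow (hΦ0 Q) hβ0.ne']
  have hroot : ∀ Q, 0 ≤ Φ Q ^ (1 / β) := fun Q => Real.rpow_nonneg (hΦ0 Q) _
  have hlow : ∀ Q, queueMax Q ≤ (U : ℝ) → queueMax Q ≤ Φ Q ^ (1 / β) := fun Q hQ => by
    rw [← Real.rpow_le_rpow_iff (queueMax_nonneg Q) (hroot Q) hβ0, hpow]
    exact (H1 Q hQ).1
  have hupp : ∀ Q, queueMax Q ≤ (U : ℝ) → Φ Q ^ (1 / β) ≤ b₁ ^ (1 / β) * queueMax Q :=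
    fun Q hQ => by
      have hb : 0 ≤ b₁ := by linarith
      rw [← Real.rpow_le_rpow_iff (hroot Q)
        (mul_nonneg (Real.rpow_nonneg hb _) (queueMax_nonneg Q)) hβ0, hpow,
        Real.mul_rpow (Real.rpow_nonneg hb _) (queueMax_nonneg Q), one_div,
        Real.rpow_inv_rpow hb hβ0.ne']
      exact (H1 Q hQ).2
  have hthr : ∀ Q, Φ Q ≤ ((U : ℝ) - W) ^ β ↔ Φ Q ^ (1 / β) ≤ (U : ℝ) - W := fun Q => by
    rw [← Real.rpow_le_rpow_iff (hroot Q) (by linarith) hβ0, hpow]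
  set M := max (b₁ ^ (1 / β) * (W : ℝ)) (2 * b₂ / β * ((1 : ℝ) + (W : ℝ)) ^ (β - 1))
  have hM0 : 0 ≤ M := le_max_of_le_left
    (mul_nonneg (Real.rpow_nonneg (by linarith) _) (Nat.cast_nonneg _))
  have hjump : ∀ Q Q' : Fin D → ℕ, queueMax Q ≤ (U : ℝ) → queueMax Q' ≤ (U : ℝ) →
      (∀ i, |(Q' i : ℝ) - (Q i : ℝ)| ≤ (W : ℝ)) →
      Φ Q' ^ (1 / β) - Φ Q ^ (1 / β) ≤ M := by
    intro Q Q' hQ hQ' h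
    have hle := queueMax_le_add W Q Q' h
    rcases queueMax_eq_zero_or_one_le Q with h0 | h1
    · refine le_max_of_le_left ?_
      have : b₁ ^ (1 / β) * queueMax Q' ≤ b₁ ^ (1 / β) * W :=
        mul_le_mul_of_nonneg_left (by linarith) (Real.rpow_nonneg (by linarith) _)
      linarith [hupp Q' hQ', hroot Q]
    · refine le_max_of_le_right (sub_le_of_rpow_sub_rpow_le hβ hb₂ (Nat.cast_nonneg _) h1
        (hlow Q hQ) (queueMax_nonneg Q') hle (hroot Q') ?_)
      rw [hpow, hpow]
      exact (le_abs_self _).trans (H2 Q Q' hQ hQ' h)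
  have hone : ∀ Q Q' : Fin D → ℕ, (∀ i, |(Q' i : ℝ) - (Q i : ℝ)| ≤ (W : ℝ)) →
      linPhi W U β Φ Q' - linPhi W U β Φ Q ≤ M := by
    intro Q Q' h
    unfold linPhi
    simp only [hthr]
    split_ifs with hin' hin hin
    · exact hjump Q Q' hin.1 hin'.1 h
    · linarith [hin'.2]
    · have hQ' : queueMax Q' ≤ U := by
        linarith [queueMax_le_add W Q Q' h, hlow Q hin.1, hin.2]
      have := not_le.mp fun hh => hin' ⟨hQ', hh⟩
      linarith [hjump Q Q' hin.1 hQ' h]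
    · linarith
  intro Q Q' h
  refine abs_sub_le_iff.mpr ⟨hone Q Q' h, hone Q' Q fun i => ?_⟩
  rw [abs_sub_comm]
  exact h i
end

section
/- Let J, K₀, n be natural numbers with J ≥ 1, K₀ ≥ 1, n ≥ 1, and let ℓ be a real number with 0 < ℓ ≤ 1. Then Binomial(J+n, n) · (1 − ℓ/(2·√(K₀+J+n−1)))^n ≤ ( 4^{J+2} · (2J+4)! · (K₀+J)^{2J+2} ) / ( J! · ℓ^{2J+4} · n² ). -/
/-- Bernoulli-type tail bound: `(1 - x)^n` decays faster than any power of `n * x`. -/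
lemma one_sub_pow_le_factorial_div_pow {x : ℝ} (hx0 : 0 < x) (hx1 : x ≤ 1) {n : ℕ}
    (hn : 0 < n) (m : ℕ) :
    (1 - x) ^ n ≤ (m.factorial : ℝ) / (n * x) ^ m := by
  have hnx : 0 < (n : ℝ) * x := by positivity
  calc (1 - x) ^ n ≤ Real.exp (-x) ^ n :=
        pow_le_pow_left₀ (by linarith) (Real.one_sub_le_exp_neg x) n
    _ = (Real.exp (n * x))⁻¹ := by rw [← Real.exp_nat_mul, ← Real.exp_neg, mul_neg]
    _ ≤ ((n * x) ^ m / (m.factorial : ℝ))⁻¹ :=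
        inv_anti₀ (by positivity) (Real.pow_div_factorial_le_exp _ hnx.le m)
    _ = (m.factorial : ℝ) / (n * x) ^ m := inv_div _ _

/-- Binomial–exponential tail bound from the proof of Theorem 1: for `J, K₀, n ≥ 1`
and `0 < ℓ ≤ 1`,
`C(J+n, n)·(1 − ℓ/(2√(K₀+J+n−1)))^n ≤ 4^(J+2)·(2J+4)!·(K₀+J)^(2J+2) / (J!·ℓ^(2J+4)·n²)`. -/
theorem stmt_7 (J K₀ n : ℕ) (hJ : 1 ≤ J) (hK : 1 ≤ K₀) (hn : 1 ≤ n)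
    (ℓ : ℝ) (hl0 : 0 < ℓ) (hl1 : ℓ ≤ 1) :
    ((J + n).choose n : ℝ) * (1 - ℓ / (2 * Real.sqrt ((K₀ : ℝ) + J + n - 1))) ^ n ≤
      4 ^ (J + 2) * ((2 * J + 4).factorial : ℝ) * ((K₀ : ℝ) + J) ^ (2 * J + 2) /
        ((J.factorial : ℝ) * ℓ ^ (2 * J + 4) * (n : ℝ) ^ 2) := by
  have hJ' : (1 : ℝ) ≤ J := by exact_mod_cast hJ
  have hK' : (1 : ℝ) ≤ K₀ := by exact_mod_cast hK
  have hn' : (1 : ℝ) ≤ n := by exact_mod_cast hn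
  set M : ℝ := (K₀ : ℝ) + J + n - 1 with hM
  have hM1 : 1 ≤ M := by linarith
  have hs : 1 ≤ √M := Real.one_le_sqrt.2 hM1
  have hx1 : ℓ / (2 * √M) ≤ 1 := (div_le_one (by positivity)).2 (by linarith)
  have hchoose : ((J + n).choose n : ℝ) ≤ M ^ J / (J.factorial : ℝ) := by
    rw [Nat.choose_symm_add.symm]
    refine (Nat.choose_le_pow_div J (J + n)).trans ?_
    gcongr
    push_cast
    linarith
  have hMn : M ≤ (K₀ + J) * n := by nlinarith
  have hpow : (n * (ℓ / (2 * √M))) ^ (2 * J + 4) =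
      (n : ℝ) ^ (2 * J + 4) * ℓ ^ (2 * J + 4) / (4 ^ (J + 2) * M ^ (J + 2)) := by
    have h : (2 * √M) ^ (2 * J + 4) = 4 ^ (J + 2) * M ^ (J + 2) := by
      rw [show 2 * J + 4 = 2 * (J + 2) by ring, pow_mul, mul_pow, Real.sq_sqrt (by linarith),
        mul_pow]
      norm_num
    rw [mul_pow, div_pow, h, mul_div_assoc]
  calc ((J + n).choose n : ℝ) * (1 - ℓ / (2 * √M)) ^ n
      ≤ M ^ J / (J.factorial : ℝ) *
          (((2 * J + 4).factorial : ℝ) / (n * (ℓ / (2 * √M))) ^ (2 * J + 4)) :=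
        mul_le_mul hchoose (one_sub_pow_le_factorial_div_pow (by positivity) hx1 hn _)
          (pow_nonneg (by linarith) n) (by positivity)
    _ = 4 ^ (J + 2) * ((2 * J + 4).factorial : ℝ) * M ^ (2 * J + 2) /
          ((J.factorial : ℝ) * ℓ ^ (2 * J + 4) * (n : ℝ) ^ (2 * J + 4)) := by
        rw [hpow]
        field_simp
        ring
    _ ≤ 4 ^ (J + 2) * ((2 * J + 4).factorial : ℝ) * ((K₀ + J) * n) ^ (2 * J + 2) /
          ((J.factorial : ℝ) * ℓ ^ (2 * J + 4) * (n : ℝ) ^ (2 * J + 4)) := by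
        gcongr
    _ = _ := by
        rw [mul_pow]
        field_simp
        ring
end
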